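/- For every integer k ≥ 1, F_2(π/3, 2^{k+1}) ≥ √3·k − 1. -/

import Mathlib

open Real

noncomputable section

/-- Vertex set of a full Steiner topology on `n` terminals:
`n` terminals and `n - 2` Steiner points. -/
abbrev SteinerVert (n : ℕ) := Fin n ⊕ Fin (n - 2)

/-- Euclidean space `ℝ^d`. -/
abbrev Epc (d : ℕ) := EuclideanSpace ℝ (Fin d)

/-- A full Steiner topology on `n` terminals: a tree on `n` terminals and `n - 2`
Steiner points in which every terminal has degree `1` and every Steiner point has
degree `3`. -/
structure FullSteinerTopology (n : ℕ) where
  graph : SimpleGraph (SteinerVert n)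
  isTree : graph.IsTree
  degTerminal : ∀ t : Fin n, (graph.neighborSet (Sum.inl t)).ncard = 1
  degSteiner : ∀ s : Fin (n - 2), (graph.neighborSet (Sum.inr s)).ncard = 3

open Classical in
/-- The total length of the Steiner tree obtained by realizing the topology `G`
via the placement `pos`, i.e. the sum of the Euclidean lengths of its edges. -/
noncomputable def treeLength {n d : ℕ} (G : FullSteinerTopology n)
    (pos : SteinerVert n → Epc d) : ℝ :=
  (1 / 2) * ∑ u : SteinerVert n, ∑ v : SteinerVert n,
    if G.graph.Adj u v then dist (pos u) (pos v) else 0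

/-- The realization `pos` of the topology `G` is a full `ε`-approximate Steiner tree:
at every Steiner point, every angle spanned by two incident edges lies in
`[2π/3 - ε, 2π/3 + ε]`. -/
def IsApproxSteiner {n d : ℕ} (ε : ℝ) (G : FullSteinerTopology n)
    (pos : SteinerVert n → Epc d) : Prop :=
  ∀ s : Fin (n - 2), ∀ u v : SteinerVert n,
    G.graph.Adj (Sum.inr s) u → G.graph.Adj (Sum.inr s) v → u ≠ v →
      |EuclideanGeometry.angle (pos u) (pos (Sum.inr s)) (pos v) - 2 * π / 3| ≤ ε

/-- A locally minimum Steiner tree: no degenerate edges, and every angle spanned by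
two edges at a common vertex is at least `2π/3`. -/
def IsLocallyMinimumTree {n d : ℕ} (G : FullSteinerTopology n)
    (pos : SteinerVert n → Epc d) : Prop :=
  (∀ u v : SteinerVert n, G.graph.Adj u v → pos u ≠ pos v) ∧
  ∀ x u v : SteinerVert n, G.graph.Adj x u → G.graph.Adj x v → u ≠ v →
    2 * π / 3 ≤ EuclideanGeometry.angle (pos u) (pos x) (pos v)

/-- The length `L(S(T))` of the shortest Steiner tree with the same topology `G` and the
same terminals as the realization `pos` (degenerate edges allowed). -/
noncomputable def minTreeLength {n d : ℕ} (G : FullSteinerTopology n)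
    (pos : SteinerVert n → Epc d) : ℝ :=
  sInf { L : ℝ | ∃ pos' : SteinerVert n → Epc d,
    (∀ t : Fin n, pos' (Sum.inl t) = pos (Sum.inl t)) ∧ L = treeLength G pos' }

/-- `F_d(ε, n)`: the supremum of `L(T)/L(S(T)) - 1` over all full `ε`-approximate
Steiner trees `T` on `n` terminals in `ℝ^d`. -/
noncomputable def steinerF (d : ℕ) (ε : ℝ) (n : ℕ) : ℝ :=
  sSup { r : ℝ | ∃ (G : FullSteinerTopology n) (pos : SteinerVert n → Epc d),
    IsApproxSteiner ε G pos ∧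
    r = treeLength G pos / minTreeLength G pos - 1 }

/-- `G_d(ε, n)`: the supremum of `L(T)/L(S(T)) - 1` over all full `ε`-approximate
Steiner trees `T` on `n` terminals in `ℝ^d` such that the shortest tree `S(T)` with the
same terminals and topology is a (non-degenerate) locally minimum Steiner tree. -/
noncomputable def steinerG (d : ℕ) (ε : ℝ) (n : ℕ) : ℝ :=
  sSup { r : ℝ | ∃ (G : FullSteinerTopology n)
    (pos pos' : SteinerVert n → Epc d),
    IsApproxSteiner ε G pos ∧
    (∀ t : Fin n, pos' (Sum.inl t) = pos (Sum.inl t)) ∧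
    treeLength G pos' = minTreeLength G pos ∧
    IsLocallyMinimumTree G pos' ∧
    r = treeLength G pos / minTreeLength G pos - 1 }


/-! ### Upper bounds on approximate Steiner trees -/

section UpperBound

variable {n d : ℕ}

/-- In a tree, a vertex has at most one neighbour that is closer to the root `r`. -/
theorem SimpleGraph.IsTree.eq_of_adj_of_dist_add_one_eq {V : Type*} {G : SimpleGraph V}
    (hG : G.IsTree) {r v u w : V} (hu : G.Adj v u) (hw : G.Adj v w)
    (hdu : G.dist r u + 1 = G.dist r v) (hdw : G.dist r w + 1 = G.dist r v) : u = w := by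
  obtain ⟨p, hp⟩ := hG.connected.exists_walk_length_eq_dist r u
  obtain ⟨q, hq⟩ := hG.connected.exists_walk_length_eq_dist r w
  have hp' : (p.concat hu.symm).IsPath :=
    SimpleGraph.Walk.isPath_of_length_eq_dist _ (by simp [hp, hdu])
  have hq' : (q.concat hw.symm).IsPath :=
    SimpleGraph.Walk.isPath_of_length_eq_dist _ (by simp [hq, hdw])
  have h := (hG.existsUnique_path r v).unique hp' hq'
  simpa using congrArg SimpleGraph.Walk.penultimate h

/-- A Steiner point has two distinct neighbours that are farther from the root `r`. -/
theorem FullSteinerTopology.exists_two_children (G : FullSteinerTopology n)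
    (r : SteinerVert n) (s : Fin (n - 2)) :
    ∃ u v, u ≠ v ∧ G.graph.Adj (Sum.inr s) u ∧ G.graph.Adj (Sum.inr s) v ∧
      G.graph.dist r u = G.graph.dist r (Sum.inr s) + 1 ∧
      G.graph.dist r v = G.graph.dist r (Sum.inr s) + 1 := by
  obtain ⟨x, y, z, hxy, hxz, hyz, hs⟩ := Set.ncard_eq_three.1 (G.degSteiner s)
  have hx : G.graph.Adj (Sum.inr s) x := by
    rw [← SimpleGraph.mem_neighborSet, hs]; simp
  have hy : G.graph.Adj (Sum.inr s) y := by
    rw [← SimpleGraph.mem_neighborSet, hs]; simp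
  have hz : G.graph.Adj (Sum.inr s) z := by
    rw [← SimpleGraph.mem_neighborSet, hs]; simp
  have key : ∀ a b, a ≠ b → G.graph.Adj (Sum.inr s) a → G.graph.Adj (Sum.inr s) b →
      G.graph.dist r a = G.graph.dist r (Sum.inr s) + 1 ∨
      G.graph.dist r b = G.graph.dist r (Sum.inr s) + 1 := by
    intro a b hab ha hb
    rcases G.isTree.dist_eq_dist_add_one_of_adj r ha with h1 | h1
    · rcases G.isTree.dist_eq_dist_add_one_of_adj r hb with h2 | h2
      · exact absurd (G.isTree.eq_of_adj_of_dist_add_one_eq ha hb h1.symm h2.symm) hab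
      · exact Or.inr h2
    · exact Or.inl h1
  rcases key x y hxy hx hy with h1 | h1
  · rcases key y z hyz hy hz with h2 | h2
    · exact ⟨x, y, hxy, hx, hy, h1, h2⟩
    · exact ⟨x, z, hxz, hx, hz, h1, h2⟩
  · rcases key x z hxz hx hz with h2 | h2
    · exact ⟨x, y, hxy, hx, hy, h2, h1⟩
    · exact ⟨y, z, hyz, hy, hz, h1, h2⟩

theorem dist_add_dist_le_of_pi_div_three_le_angle {a o b : Epc d}
    (h : π / 3 ≤ EuclideanGeometry.angle a o b) :
    dist a o + dist b o ≤ 2 * dist a b := by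
  have hcos : Real.cos (EuclideanGeometry.angle a o b) ≤ 1 / 2 := by
    rw [← Real.cos_pi_div_three]
    exact Real.cos_le_cos_of_nonneg_of_le_pi (by positivity)
      (EuclideanGeometry.angle_le_pi _ _ _) h
  have hl := EuclideanGeometry.law_cos a o b
  have h1 : 0 ≤ dist a o := dist_nonneg
  have h2 : 0 ≤ dist b o := dist_nonneg
  have h3 : 0 ≤ dist a b := dist_nonneg
  have h4 := mul_le_mul_of_nonneg_left hcos (mul_nonneg h1 h2)
  nlinarith [sq_nonneg (dist a o - dist b o)]

theorem dist_le_three_mul_of_pi_div_three_le_angle {a o b p : Epc d} {R : ℝ}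
    (h : π / 3 ≤ EuclideanGeometry.angle a o b) (ha : dist a p ≤ R) (hb : dist b p ≤ R) :
    dist o p ≤ 3 * R := by
  have h1 := dist_add_dist_le_of_pi_div_three_le_angle h
  have h2 := dist_triangle_right a b p
  have h3 := dist_triangle_left o p a
  have h4 := dist_triangle_left o p b
  linarith

theorem IsApproxSteiner.dist_le {G : FullSteinerTopology n} {pos : SteinerVert n → Epc d}
    (h : IsApproxSteiner (π / 3) G pos) (r : Fin n) {R : ℝ}
    (hR : ∀ t : Fin n, dist (pos (Sum.inl t)) (pos (Sum.inl r)) ≤ R) (v : SteinerVert n) :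
    dist (pos v) (pos (Sum.inl r)) ≤ 3 ^ Fintype.card (SteinerVert n) * R := by
  have hR0 : 0 ≤ R := dist_nonneg.trans (hR r)
  have key : ∀ (j : ℕ) (v : SteinerVert n),
      Fintype.card (SteinerVert n) ≤ G.graph.dist (Sum.inl r) v + j →
      dist (pos v) (pos (Sum.inl r)) ≤ 3 ^ j * R := by
    intro j
    induction j with
    | zero =>
      intro v hv
      obtain ⟨p, hp, hp'⟩ := G.isTree.connected.exists_path_of_dist (Sum.inl r) v
      have := hp.length_lt
      omega
    | succ j ih =>
      rintro (t | s) hv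
      · exact (hR t).trans (le_mul_of_one_le_left hR0 (one_le_pow₀ (by norm_num)))
      · obtain ⟨a, b, hab, ha, hb, hda, hdb⟩ := G.exists_two_children (Sum.inl r) s
        have hang := (abs_le.1 (h s a b ha hb hab)).1
        rw [pow_succ', mul_assoc]
        exact dist_le_three_mul_of_pi_div_three_le_angle (by linarith)
          (ih a (by omega)) (ih b (by omega))
  exact key _ v (by omega)

theorem dist_le_two_mul_treeLength {G : FullSteinerTopology n} (pos : SteinerVert n → Epc d)
    {u v : SteinerVert n} (h : G.graph.Adj u v) :
    dist (pos u) (pos v) ≤ 2 * treeLength G pos := by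
  classical
  have hnn : ∀ u v : SteinerVert n,
      0 ≤ if G.graph.Adj u v then dist (pos u) (pos v) else 0 := by
    intro u v; split_ifs <;> positivity
  calc dist (pos u) (pos v)
      = if G.graph.Adj u v then dist (pos u) (pos v) else 0 := by simp [h]
    _ ≤ ∑ w, if G.graph.Adj u w then dist (pos u) (pos w) else 0 :=
        Finset.single_le_sum (f := fun w ↦ if G.graph.Adj u w then dist (pos u) (pos w) else 0)
          (fun w _ ↦ hnn u w) (Finset.mem_univ v)
    _ ≤ ∑ x, ∑ w, if G.graph.Adj x w then dist (pos x) (pos w) else 0 :=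
        Finset.single_le_sum
          (f := fun x ↦ ∑ w, if G.graph.Adj x w then dist (pos x) (pos w) else 0)
          (fun x _ ↦ Finset.sum_nonneg fun w _ ↦ hnn x w) (Finset.mem_univ u)
    _ = 2 * treeLength G pos := by
        unfold treeLength
        rw [← mul_assoc]
        norm_num

theorem treeLength_nonneg (G : FullSteinerTopology n) (pos : SteinerVert n → Epc d) :
    0 ≤ treeLength G pos := by
  unfold treeLength
  refine mul_nonneg (by norm_num) (Finset.sum_nonneg fun u _ ↦ Finset.sum_nonneg fun v _ ↦ ?_)
  split_ifs <;> positivity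

theorem dist_le_length_mul_treeLength {G : FullSteinerTopology n} (pos : SteinerVert n → Epc d)
    {u v : SteinerVert n} (p : G.graph.Walk u v) :
    dist (pos u) (pos v) ≤ p.length * (2 * treeLength G pos) := by
  induction p with
  | nil => simp
  | cons h p ih =>
    rw [SimpleGraph.Walk.length_cons]
    push_cast
    have h1 := dist_le_two_mul_treeLength pos h
    have h2 := dist_triangle (pos _) (pos _) (pos _) |>.trans (add_le_add h1 ih)
    linarith

theorem dist_le_card_mul_treeLength (G : FullSteinerTopology n) (pos : SteinerVert n → Epc d)
    (u v : SteinerVert n) :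
    dist (pos u) (pos v) ≤ Fintype.card (SteinerVert n) * (2 * treeLength G pos) := by
  obtain ⟨p, hp, -⟩ := G.isTree.connected.exists_path_of_dist u v
  refine (dist_le_length_mul_treeLength pos p).trans ?_
  have h0 := treeLength_nonneg G pos
  have : (p.length : ℝ) ≤ Fintype.card (SteinerVert n) := by exact_mod_cast hp.length_lt.le
  gcongr

theorem treeLength_le_of_dist_le (G : FullSteinerTopology n) (pos : SteinerVert n → Epc d)
    {c : Epc d} {R : ℝ} (h : ∀ v, dist (pos v) c ≤ R) :
    treeLength G pos ≤ (Fintype.card (SteinerVert n) : ℝ) ^ 2 * R := by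
  unfold treeLength
  have hb : ∀ u v : SteinerVert n,
      (open Classical in if G.graph.Adj u v then dist (pos u) (pos v) else 0) ≤ 2 * R := by
    intro u v
    have h1 := dist_triangle_right (pos u) (pos v) c
    have h2 := h u
    have h3 := h v
    have h4 : 0 ≤ R := dist_nonneg.trans h2
    split_ifs <;> linarith
  have h1 := Finset.sum_le_sum fun u (_ : u ∈ Finset.univ) ↦
    Finset.sum_le_sum fun v (_ : v ∈ Finset.univ) ↦ hb u v
  rw [Finset.sum_const, Finset.sum_const, Finset.card_univ, nsmul_eq_mul, nsmul_eq_mul] at h1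
  linarith

/-- A constant bounding the ratio between the length of an approximate Steiner tree and that
of any tree with the same terminals and topology. -/
def ratioBound (n : ℕ) : ℝ :=
  (Fintype.card (SteinerVert n) : ℝ) ^ 2 * (3 ^ Fintype.card (SteinerVert n) *
    (Fintype.card (SteinerVert n) * 2))

theorem ratioBound_pos (hn : 0 < n) : 0 < ratioBound n := by
  have : 0 < Fintype.card (SteinerVert n) := Fintype.card_pos_iff.2 ⟨Sum.inl ⟨0, hn⟩⟩
  unfold ratioBound
  positivity

theorem IsApproxSteiner.treeLength_le {G : FullSteinerTopology n} {pos : SteinerVert n → Epc d}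
    (hn : 0 < n) (h : IsApproxSteiner (π / 3) G pos) (pos' : SteinerVert n → Epc d)
    (hpos' : ∀ t : Fin n, pos' (Sum.inl t) = pos (Sum.inl t)) :
    treeLength G pos ≤ ratioBound n * treeLength G pos' := by
  have h1 := h.dist_le ⟨0, hn⟩ (R := Fintype.card (SteinerVert n) * (2 * treeLength G pos'))
    (fun t ↦ by rw [← hpos', ← hpos']; exact dist_le_card_mul_treeLength G pos' _ _)
  refine (treeLength_le_of_dist_le G pos h1).trans (le_of_eq ?_)
  unfold ratioBound
  ring

theorem IsApproxSteiner.treeLength_le_minTreeLength {G : FullSteinerTopology n}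
    {pos : SteinerVert n → Epc d} (hn : 0 < n) (h : IsApproxSteiner (π / 3) G pos) :
    treeLength G pos ≤ ratioBound n * minTreeLength G pos := by
  have hK := ratioBound_pos hn
  rw [mul_comm, ← div_le_iff₀ hK]
  refine le_csInf ⟨_, pos, fun _ ↦ rfl, rfl⟩ ?_
  rintro L ⟨pos', hpos', rfl⟩
  rw [div_le_iff₀ hK, mul_comm]
  exact h.treeLength_le hn pos' hpos'

theorem minTreeLength_nonneg (G : FullSteinerTopology n) (pos : SteinerVert n → Epc d) :
    0 ≤ minTreeLength G pos := by
  refine Real.sInf_nonneg ?_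
  rintro L ⟨pos', -, rfl⟩
  exact treeLength_nonneg G pos'

theorem minTreeLength_le {G : FullSteinerTopology n} {pos : SteinerVert n → Epc d}
    (pos' : SteinerVert n → Epc d)
    (hpos' : ∀ t : Fin n, pos' (Sum.inl t) = pos (Sum.inl t)) :
    minTreeLength G pos ≤ treeLength G pos' := by
  refine csInf_le ⟨0, ?_⟩ ⟨pos', hpos', rfl⟩
  rintro L ⟨pos'', -, rfl⟩
  exact treeLength_nonneg G pos''

theorem IsApproxSteiner.ratio_le_steinerF {G : FullSteinerTopology n}
    {pos : SteinerVert n → Epc d} (hn : 0 < n) (h : IsApproxSteiner (π / 3) G pos) :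
    treeLength G pos / minTreeLength G pos - 1 ≤ steinerF d (π / 3) n := by
  refine le_csSup ⟨ratioBound n - 1, ?_⟩ ⟨G, pos, h, rfl⟩
  rintro r ⟨G', pos', h', rfl⟩
  exact sub_le_sub_right (div_le_of_le_mul₀ (minTreeLength_nonneg _ _) (ratioBound_pos hn).le
    (h'.treeLength_le_minTreeLength hn)) 1

end UpperBound

/-! ### The caterpillar topology -/

section Caterpillar

variable {n : ℕ}

/-- The caterpillar: Steiner points form a path; every Steiner point carries one terminal, and
the two ends of the path carry one more terminal each. -/
def caterpillarGraph (n : ℕ) : SimpleGraph (SteinerVert n) :=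
  SimpleGraph.fromRel fun u v ↦
    match u, v with
    | Sum.inl t, Sum.inr s => t.val = s.val + 1 ∨ (t.val = 0 ∧ s.val = 0) ∨
        (t.val = n - 1 ∧ s.val = n - 3)
    | Sum.inr s, Sum.inr s' => s.val + 1 = s'.val
    | _, _ => False

/-- The neighbour of a Steiner point of the caterpillar preceding it on the spine. -/
def spinePrev (hn : 4 ≤ n) (s : Fin (n - 2)) : SteinerVert n :=
  if s.val = 0 then Sum.inl ⟨0, by omega⟩ else Sum.inr ⟨s.val - 1, by omega⟩

/-- The neighbour of a Steiner point of the caterpillar following it on the spine. -/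
def spineNext (hn : 4 ≤ n) (s : Fin (n - 2)) : SteinerVert n :=
  if h : s.val = n - 3 then Sum.inl ⟨n - 1, by omega⟩ else Sum.inr ⟨s.val + 1, by omega⟩

/-- The terminal hanging off a Steiner point of the caterpillar. -/
def caterpillarLeg (s : Fin (n - 2)) : SteinerVert n :=
  Sum.inl ⟨s.val + 1, by omega⟩

/-- The Steiner point carrying a given terminal of the caterpillar. -/
def legAnchor (hn : 4 ≤ n) (t : Fin n) : Fin (n - 2) :=
  ⟨min (t.val - 1) (n - 3), by omega⟩

theorem caterpillarGraph_adj_inr (hn : 4 ≤ n) (s : Fin (n - 2)) (u : SteinerVert n) :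
    (caterpillarGraph n).Adj (Sum.inr s) u ↔
      u = spinePrev hn s ∨ u = spineNext hn s ∨ u = caterpillarLeg s := by
  obtain ⟨s, hs⟩ := s
  rcases u with ⟨t, ht⟩ | ⟨t, ht⟩ <;>
    simp only [caterpillarGraph, SimpleGraph.fromRel_adj, spinePrev, spineNext,
      caterpillarLeg] <;> split_ifs <;> simp <;> omega

theorem caterpillarGraph_adj_inl (hn : 4 ≤ n) (t : Fin n) (u : SteinerVert n) :
    (caterpillarGraph n).Adj (Sum.inl t) u ↔ u = Sum.inr (legAnchor hn t) := by
  obtain ⟨t, ht⟩ := t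
  rcases u with ⟨s, hs⟩ | ⟨s, hs⟩ <;>
    simp only [caterpillarGraph, SimpleGraph.fromRel_adj, legAnchor] <;> simp <;> omega

theorem spine_distinct (hn : 4 ≤ n) (s : Fin (n - 2)) :
    spinePrev hn s ≠ spineNext hn s ∧ spinePrev hn s ≠ caterpillarLeg s ∧
      spineNext hn s ≠ caterpillarLeg s := by
  obtain ⟨s, hs⟩ := s
  simp only [spinePrev, spineNext, caterpillarLeg]
  split_ifs <;> simp <;> omega

theorem caterpillarGraph_neighborSet_inl (hn : 4 ≤ n) (t : Fin n) :
    (caterpillarGraph n).neighborSet (Sum.inl t) = {Sum.inr (legAnchor hn t)} := by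
  ext u
  simp [caterpillarGraph_adj_inl hn]

theorem caterpillarGraph_neighborSet_inr (hn : 4 ≤ n) (s : Fin (n - 2)) :
    (caterpillarGraph n).neighborSet (Sum.inr s) =
      {spinePrev hn s, spineNext hn s, caterpillarLeg s} := by
  ext u
  simp [caterpillarGraph_adj_inr hn]

theorem caterpillarGraph_ncard_inl (hn : 4 ≤ n) (t : Fin n) :
    ((caterpillarGraph n).neighborSet (Sum.inl t)).ncard = 1 := by
  rw [caterpillarGraph_neighborSet_inl hn, Set.ncard_singleton]

theorem caterpillarGraph_ncard_inr (hn : 4 ≤ n) (s : Fin (n - 2)) :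
    ((caterpillarGraph n).neighborSet (Sum.inr s)).ncard = 3 := by
  obtain ⟨h1, h2, h3⟩ := spine_distinct hn s
  exact Set.ncard_eq_three.2 ⟨_, _, _, h1, h2, h3, caterpillarGraph_neighborSet_inr hn s⟩

theorem caterpillarGraph_connected (hn : 4 ≤ n) : (caterpillarGraph n).Connected := by
  have hs : ∀ (i : ℕ) (hi : i < n - 2),
      (caterpillarGraph n).Reachable (Sum.inr ⟨0, by omega⟩) (Sum.inr ⟨i, hi⟩) := by
    intro i
    induction i with
    | zero => intro _; exact SimpleGraph.Reachable.refl _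
    | succ i ih =>
      intro hi
      refine (ih (by omega)).trans (SimpleGraph.Adj.reachable ?_)
      simp [caterpillarGraph]
  rw [SimpleGraph.connected_iff_exists_forall_reachable]
  refine ⟨Sum.inr ⟨0, by omega⟩, ?_⟩
  rintro (t | ⟨i, hi⟩)
  · have h : (caterpillarGraph n).Adj (Sum.inl t) (Sum.inr (legAnchor hn t)) := by
      rw [caterpillarGraph_adj_inl hn]
    exact (hs _ _).trans h.symm.reachable
  · exact hs i hi

theorem caterpillarGraph_isTree (hn : 4 ≤ n) : (caterpillarGraph n).IsTree := by
  classical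
  rw [SimpleGraph.isTree_iff_connected_and_card]
  refine ⟨caterpillarGraph_connected hn, ?_⟩
  have hdeg : ∀ v, (caterpillarGraph n).degree v =
      ((caterpillarGraph n).neighborSet v).ncard := by
    intro v
    rw [← SimpleGraph.card_neighborSet_eq_degree, Set.ncard_eq_toFinset_card', Set.toFinset_card]
  have h := (caterpillarGraph n).sum_degrees_eq_twice_card_edges
  rw [Fintype.sum_sum_type] at h
  simp only [hdeg, caterpillarGraph_ncard_inl hn, caterpillarGraph_ncard_inr hn,
    Finset.sum_const, Finset.card_univ, Fintype.card_fin, smul_eq_mul] at h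
  rw [Nat.card_eq_fintype_card, Nat.card_eq_fintype_card, ← SimpleGraph.edgeFinset_card,
    Fintype.card_sum, Fintype.card_fin, Fintype.card_fin]
  omega

/-- The caterpillar as a full Steiner topology. -/
def caterpillar (hn : 4 ≤ n) : FullSteinerTopology n where
  graph := caterpillarGraph n
  isTree := caterpillarGraph_isTree hn
  degTerminal := caterpillarGraph_ncard_inl hn
  degSteiner := caterpillarGraph_ncard_inr hn

end Caterpillar

/-! ### A caterpillar wound around a hexagon -/

section Hexagon

variable {n : ℕ}

/-- The `i`-th vertex, counted cyclically, of the regular hexagon inscribed in the unit circle. -/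
def hexVertex (i : ℕ) : Epc 2 := !₂[Real.cos (i * (π / 3)), Real.sin (i * (π / 3))]

theorem dist_hexVertex_zero (i : ℕ) : dist (hexVertex i) 0 = 1 := by
  rw [EuclideanSpace.dist_eq]
  simp [hexVertex, Fin.sum_univ_two]

theorem dist_hexVertex_sq (i j : ℕ) : dist (hexVertex (i + j)) (hexVertex i) ^ 2 =
    2 - 2 * Real.cos (j * (π / 3)) := by
  rw [EuclideanSpace.dist_eq, Real.sq_sqrt (by positivity)]
  simp only [hexVertex, Fin.sum_univ_two, Real.dist_eq, sq_abs]
  have h : (j : ℝ) * (π / 3) = ((i + j : ℕ) : ℝ) * (π / 3) - i * (π / 3) := by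
    push_cast; ring
  rw [h, Real.cos_sub]
  simp only [Matrix.cons_val_zero, Matrix.cons_val_one]
  linear_combination Real.sin_sq_add_cos_sq (((i + j : ℕ) : ℝ) * (π / 3)) +
    Real.sin_sq_add_cos_sq ((i : ℝ) * (π / 3))

theorem dist_hexVertex_succ (i : ℕ) : dist (hexVertex (i + 1)) (hexVertex i) = 1 := by
  have h := dist_hexVertex_sq i 1
  rw [Nat.cast_one, one_mul, Real.cos_pi_div_three] at h
  have h0 : 0 ≤ dist (hexVertex (i + 1)) (hexVertex i) := dist_nonneg
  nlinarith

theorem one_le_dist_hexVertex_add_two (i : ℕ) :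
    1 ≤ dist (hexVertex (i + 2)) (hexVertex i) := by
  have h := dist_hexVertex_sq i 2
  rw [Nat.cast_two, Real.cos_two_mul, Real.cos_pi_div_three] at h
  have h0 : 0 ≤ dist (hexVertex (i + 2)) (hexVertex i) := dist_nonneg
  nlinarith

theorem abs_angle_sub_le_of_one_le_dist {d : ℕ} {a o b : Epc d} (ha : dist a o = 1)
    (hb : dist b o = 1) (hab : 1 ≤ dist a b) :
    |EuclideanGeometry.angle a o b - 2 * π / 3| ≤ π / 3 := by
  have hpi := EuclideanGeometry.angle_le_pi a o b
  have h0 := EuclideanGeometry.angle_nonneg a o b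
  have hl := EuclideanGeometry.law_cos a o b
  rw [ha, hb] at hl
  have hge : π / 3 ≤ EuclideanGeometry.angle a o b := by
    by_contra! hlt
    have := Real.cos_lt_cos_of_nonneg_of_le_pi h0 (by linarith [Real.pi_pos]) hlt
    rw [Real.cos_pi_div_three] at this
    nlinarith
  rw [abs_le]
  constructor <;> linarith

/-- The terminals of the wound caterpillar: the first and the last lie on the hexagon, all
others at its centre. -/
def hexTerminal (t : Fin n) : Epc 2 :=
  if t.val = 0 ∨ t.val = n - 1 then hexVertex t.val else 0

/-- The caterpillar whose spine runs around the hexagon. -/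
def hexPlacement : SteinerVert n → Epc 2 :=
  Sum.elim hexTerminal fun s ↦ hexVertex (s.val + 1)

/-- The tree on the same terminals with all Steiner points at the centre of the hexagon. -/
def centralPlacement : SteinerVert n → Epc 2 :=
  Sum.elim hexTerminal fun _ ↦ 0

theorem hexPlacement_spinePrev (hn : 4 ≤ n) (s : Fin (n - 2)) :
    hexPlacement (spinePrev hn s) = hexVertex s.val := by
  unfold spinePrev
  split_ifs with h
  · simp [hexPlacement, hexTerminal, h]
  · simp only [hexPlacement, Sum.elim_inr]
    congr 1
    omega

theorem hexPlacement_spineNext (hn : 4 ≤ n) (s : Fin (n - 2)) :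
    hexPlacement (spineNext hn s) = hexVertex (s.val + 2) := by
  unfold spineNext
  split_ifs with h
  · simp only [hexPlacement, hexTerminal, Sum.elim_inl, or_true, if_true]
    congr 1
    omega
  · simp [hexPlacement]

theorem hexPlacement_caterpillarLeg (s : Fin (n - 2)) :
    hexPlacement (caterpillarLeg s) = 0 := by
  have h := s.isLt
  simp only [hexPlacement, hexTerminal, caterpillarLeg, Sum.elim_inl]
  rw [if_neg (by omega)]

theorem dist_hexPlacement_inr (hn : 4 ≤ n) {s : Fin (n - 2)} {u : SteinerVert n}
    (h : (caterpillarGraph n).Adj (Sum.inr s) u) :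
    dist (hexPlacement u) (hexPlacement (Sum.inr s)) = 1 := by
  have hs : hexPlacement (Sum.inr s : SteinerVert n) = hexVertex (s.val + 1) := rfl
  rw [hs]
  rcases (caterpillarGraph_adj_inr hn s u).1 h with rfl | rfl | rfl
  · rw [hexPlacement_spinePrev, dist_comm, dist_hexVertex_succ]
  · rw [hexPlacement_spineNext, dist_hexVertex_succ]
  · rw [hexPlacement_caterpillarLeg, dist_comm, dist_hexVertex_zero]

theorem dist_hexPlacement (hn : 4 ≤ n) {u v : SteinerVert n}
    (h : (caterpillarGraph n).Adj u v) : dist (hexPlacement u) (hexPlacement v) = 1 := by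
  rcases u with t | s
  · have hv := (caterpillarGraph_adj_inl hn t v).1 h
    subst hv
    exact dist_hexPlacement_inr hn h.symm
  · rw [dist_comm]
    exact dist_hexPlacement_inr hn h

theorem isApproxSteiner_hexPlacement (hn : 4 ≤ n) :
    IsApproxSteiner (π / 3) (caterpillar hn) hexPlacement := by
  intro s u v hu hv huv
  refine abs_angle_sub_le_of_one_le_dist (dist_hexPlacement_inr hn hu)
    (dist_hexPlacement_inr hn hv) ?_
  have h2 := one_le_dist_hexVertex_add_two s.val
  rcases (caterpillarGraph_adj_inr hn s u).1 hu with rfl | rfl | rfl <;>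
    rcases (caterpillarGraph_adj_inr hn s v).1 hv with rfl | rfl | rfl <;>
    first
    | exact absurd rfl huv
    | (simp only [hexPlacement_spinePrev, hexPlacement_spineNext, hexPlacement_caterpillarLeg]
       first
       | exact h2
       | (rw [dist_comm]; exact h2)
       | (rw [dist_hexVertex_zero])
       | (rw [dist_comm, dist_hexVertex_zero]))

open Classical in
theorem FullSteinerTopology.sum_adj (G : FullSteinerTopology n) (u : SteinerVert n) (c : ℝ) :
    (∑ v, if G.graph.Adj u v then c else 0) = (G.graph.neighborSet u).ncard * c := by
  rw [← Finset.sum_filter, Finset.sum_const, nsmul_eq_mul, Set.ncard_eq_toFinset_card']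
  congr 3
  ext v
  simp

theorem treeLength_hexPlacement (hn : 4 ≤ n) :
    treeLength (caterpillar hn) hexPlacement = 2 * n - 3 := by
  classical
  unfold treeLength
  have h : ∀ u v : SteinerVert n,
      (if (caterpillar hn).graph.Adj u v then dist (hexPlacement u) (hexPlacement v) else 0) =
      if (caterpillar hn).graph.Adj u v then (1 : ℝ) else 0 := by
    intro u v
    split_ifs with huv
    · exact dist_hexPlacement hn huv
    · rfl
  have hc : ((n - 2 : ℕ) : ℝ) = n - 2 := by
    rw [Nat.cast_sub (by omega)]; norm_num
  simp only [h, FullSteinerTopology.sum_adj]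
  rw [Fintype.sum_sum_type]
  simp only [(caterpillar hn).degTerminal, (caterpillar hn).degSteiner, Finset.sum_const,
    Finset.card_univ, Fintype.card_fin, nsmul_eq_mul, hc]
  push_cast
  ring

open Classical in
/-- The length of a tree is at most the sum over its vertices of the degree times the norm. -/
theorem treeLength_le_sum_ncard_mul_norm {d : ℕ} (G : FullSteinerTopology n)
    (pos : SteinerVert n → Epc d) :
    treeLength G pos ≤ ∑ u, (G.graph.neighborSet u).ncard * ‖pos u‖ := by
  have h1 : (∑ u, ∑ v, if G.graph.Adj u v then dist (pos u) (pos v) else 0) ≤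
      ∑ u, ∑ v, ((if G.graph.Adj u v then ‖pos u‖ else 0) +
        if G.graph.Adj u v then ‖pos v‖ else 0) := by
    refine Finset.sum_le_sum fun u _ ↦ Finset.sum_le_sum fun v _ ↦ ?_
    split_ifs
    · exact dist_le_norm_add_norm _ _
    · simp
  have h2 : (∑ u, ∑ v, if G.graph.Adj u v then ‖pos v‖ else 0) =
      ∑ u, ∑ v, if G.graph.Adj u v then ‖pos u‖ else 0 := by
    rw [Finset.sum_comm]
    simp only [G.graph.adj_comm]
  simp only [Finset.sum_add_distrib] at h1
  rw [h2] at h1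
  simp only [G.sum_adj] at h1
  unfold treeLength
  linarith

theorem treeLength_centralPlacement_le (hn : 4 ≤ n) :
    treeLength (caterpillar hn) centralPlacement ≤ 2 := by
  refine (treeLength_le_sum_ncard_mul_norm _ _).trans ?_
  rw [Fintype.sum_sum_type]
  simp only [(caterpillar hn).degTerminal, centralPlacement, Sum.elim_inl, Sum.elim_inr,
    norm_zero, mul_zero, Finset.sum_const_zero, add_zero, Nat.cast_one, one_mul]
  have h : ∀ t : Fin n, ‖hexTerminal t‖ ≤
      (if t = ⟨0, by omega⟩ then 1 else 0) + if t = ⟨n - 1, by omega⟩ then 1 else 0 := by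
    intro t
    have h1 : ‖hexVertex t.val‖ = 1 := by rw [← dist_zero_right, dist_hexVertex_zero]
    unfold hexTerminal
    simp only [Fin.ext_iff]
    by_cases h2 : t.val = 0 <;> by_cases h3 : t.val = n - 1 <;> simp [h2, h3] <;>
      first | omega | simp_all
  refine (Finset.sum_le_sum fun t _ ↦ h t).trans ?_
  rw [Finset.sum_add_distrib]
  simp
  norm_num

theorem le_steinerF_pi_div_three (hn : 4 ≤ n) :
    (2 * n - 3) / 2 - 1 ≤ steinerF 2 (π / 3) n := by
  have hn' : (4 : ℝ) ≤ n := by exact_mod_cast hn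
  have happ := isApproxSteiner_hexPlacement hn
  refine le_trans ?_ (happ.ratio_le_steinerF (by omega))
  have h1 := happ.treeLength_le_minTreeLength (by omega)
  rw [treeLength_hexPlacement] at h1 ⊢
  have hpos : 0 < minTreeLength (caterpillar hn) hexPlacement :=
    pos_of_mul_pos_right (by linarith) (ratioBound_pos (by omega)).le
  have hle : minTreeLength (caterpillar hn) hexPlacement ≤ 2 :=
    (minTreeLength_le centralPlacement fun _ ↦ rfl).trans (treeLength_centralPlacement_le hn)
  gcongr
  linarith

end Hexagon

/-- For every integer `k ≥ 1`, `F₂(π/3, 2^(k+1)) ≥ √3·k - 1`. -/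
theorem steinerF_pi_div_three_lower_bound (k : ℕ) (hk : 1 ≤ k) :
    steinerF 2 (π / 3) (2 ^ (k + 1)) ≥ Real.sqrt 3 * (k : ℝ) - 1 := by
  have hpow' : 2 * (k + 1) ≤ 2 ^ (k + 1) := by
    have : k + 1 ≤ 2 ^ k := Nat.lt_two_pow_self
    rw [pow_succ]; omega
  have h := le_steinerF_pi_div_three (n := 2 ^ (k + 1)) (by omega)
  have hc : (2 : ℝ) * (k + 1) ≤ ((2 ^ (k + 1) : ℕ) : ℝ) := by exact_mod_cast hpow'
  have h3 : Real.sqrt 3 ≤ 2 := by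
    rw [Real.sqrt_le_left (by norm_num)]; norm_num
  have hk0 : (0 : ℝ) ≤ k := Nat.cast_nonneg k
  have := mul_le_mul_of_nonneg_right h3 hk0
  linarith

end
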